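/- arXiv:1102.1829 — 3 statements merged into one kernel-verified Lean document; each statement's English description precedes it below -/
import Mathlib

section
/- Let b ∈ ℂ, c₂,c₃ : ℤ → ℂ, and let φ₁,φ₂,φ₃,… : ℤ⁴ → ℂ (arguments (l₂,l₃,m,s)) satisfy, for all i ≥ 1, all arguments and each k = 2,3: φᵢ(…,l_k+1,…,m,s) − φᵢ(…,l_k,…,m,s) = −c_k(l_k)·φᵢ(…,l_k,…,m,s+1), and also φᵢ(l₂,l₃,m,s) − φᵢ(l₂,l₃,m−1,s) = −b·φᵢ(l₂,l₃,m,s−1). For l₁ ∈ ℕ define the l₁×l₁ Casorati determinant κ(l₁,l₂,l₃,m,s) = det( φᵢ(l₂,l₃,m,s+j−1) )_{i,j=1,…,l₁} (with κ = 1 when l₁ = 0). Then for all l₁ ∈ ℕ and all (l₂,l₃,m,s) ∈ ℤ⁴: (a) κ(l₁,·,m+1,s)·κ(l₁+1,·,m,s) − κ(l₁,·,m,s)·κ(l₁+1,·,m+1,s) = b·κ(l₁,·,m,s+1)·κ(l₁+1,·,m+1,s−1), where · stands for the unshifted (l₂,l₃); and (b) for k = 2,3: (1+c_k(l_k)b)·κ(l₁,·,m+1,s)·κ(l₁,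 l_k+1, m,s) − κ(l₁,·,m,s)·κ(l₁, l_k+1, m+1,s) = c_k(l_k)·b·κ(l₁,·,m,s+1)·κ(l₁, l_k+1, m+1,s−1), where l_k+1 indicates the k-th spatial argument shifted by 1. -/
lemma sub_cons {n : ℕ} (a c : Fin (n+1) → ℂ) (D : Fin n → Fin (n+1) → ℂ) :
  Matrix.det (Matrix.of (Fin.cons (a - c) D)) = Matrix.det (Matrix.of (Fin.cons a D))
   - Matrix.det (Matrix.of (Fin.cons c D : Fin (n+1) → Fin (n+1) → ℂ)) := by
  have h := (Matrix.detRowAlternating (n := Fin (n+1)) (R := ℂ)).toMultilinearMap.cons_add D (a-c) c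
  rw [sub_add_cancel] at h
  exact eq_sub_of_add_eq h.symm

lemma rot {n : ℕ} (x : Fin (n+1) → ℂ) (D : Fin n → Fin (n+1) → ℂ) :
  Matrix.det (Matrix.of (Fin.snoc D x : Fin (n+1) → Fin (n+1) → ℂ)) = (-1)^n * Matrix.det (Matrix.of (Fin.cons x D : Fin (n+1) → Fin (n+1) → ℂ)) := by
  rw [Fin.snoc_eq_cons_rotate]
  have := Matrix.det_permute (finRotate (n+1)) (Matrix.of (Fin.cons x D : Fin (n+1) → Fin (n+1) → ℂ))
  rw [sign_finRotate] at this
  refine Eq.trans ?_ (this.trans (by simp))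
  rfl

/-- Cramer expansion -/
lemma plucker0 {n : ℕ} (a d x y : Fin (n+2) → ℂ) (D : Fin n → Fin (n+2) → ℂ) :
  Matrix.det (Matrix.of (Fin.cons a (Fin.snoc D y) : Fin (n+2) → Fin (n+2) → ℂ)) *
  Matrix.det (Matrix.of (Fin.cons d (Fin.snoc D x) : Fin (n+2) → Fin (n+2) → ℂ)) =
  Matrix.det (Matrix.of (Fin.cons d (Fin.snoc D y) : Fin (n+2) → Fin (n+2) → ℂ)) *
  Matrix.det (Matrix.of (Fin.cons a (Fin.snoc D x) : Fin (n+2) → Fin (n+2) → ℂ)) +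
  Matrix.det (Matrix.of (Fin.cons a (Fin.snoc D d) : Fin (n+2) → Fin (n+2) → ℂ)) *
  Matrix.det (Matrix.of (Fin.cons y (Fin.snoc D x) : Fin (n+2) → Fin (n+2) → ℂ)) := by
  let M : Matrix (Fin (n+2)) (Fin (n+2)) ℂ := Matrix.of (Fin.cons a (Fin.snoc D y))
  let r : Fin (n+1) → Fin (n+2) → ℂ := Fin.snoc D x
  have h1 : ∑ i, (M.updateRow i d).det • M i = M.det • d := by
    have := Matrix.mulVec_cramer (Matrix.transpose M) d
    rw [Matrix.det_transpose, ] at this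
    rw [← this]
    ext k
    simp only [Matrix.mulVec, dotProduct, Finset.sum_apply, Pi.smul_apply, Matrix.cramer_transpose_apply, Matrix.transpose_apply, smul_eq_mul]
    exact Finset.sum_congr rfl fun i _ => mul_comm _ _
  let L : (Fin (n+2) → ℂ) →ₗ[ℂ] ℂ := 
    (Matrix.detRowAlternating (n := Fin (n+2)) (R := ℂ)).toMultilinearMap.toLinearMap (Fin.cons 0 r) 0
  have hL : ∀ v, L v = Matrix.det (Matrix.of (Fin.cons v r : Fin (n+2) → Fin (n+2) → ℂ)) := by
    intro v
    simp [L, Matrix.detRowAlternating]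
    rfl
  have h2 := congrArg L h1
  simp only [map_sum, map_smul, smul_eq_mul] at h2
  rw [Fin.sum_univ_succ, Fin.sum_univ_castSucc] at h2
  have e1 : M.updateRow 0 d = Matrix.of (Fin.cons d (Fin.snoc D y)) := by
    ext i k
    refine Fin.cases ?_ (fun i => ?_) i
    · simp
    · rw [Matrix.updateRow_ne (Fin.succ_ne_zero i)]
      simp [M]
  have e2 : M.updateRow (Fin.last n).succ d = Matrix.of (Fin.cons a (Fin.snoc D d)) := by
    ext i k
    refine Fin.cases ?_ (fun i => ?_) i
    · rw [Matrix.updateRow_ne (Fin.succ_ne_zero _).symm]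
      simp [M]
    · refine Fin.lastCases ?_ (fun i => ?_) i
      · rw [Matrix.updateRow_self, Matrix.of_apply, Fin.cons_succ, Fin.snoc_last]
      · rw [Matrix.updateRow_ne (by simpa using (Fin.castSucc_lt_last i).ne)]
        simp [M]
  have e3 : M 0 = a := by
    ext k
    simp [M]
  have e4 : M (Fin.last n).succ = y := by
    ext k
    simp only [M, Matrix.of_apply, Fin.cons_succ, Fin.snoc_last]
  have e5 : ∀ i : Fin n, L (M i.castSucc.succ) = 0 := by
    intro i
    have : M i.castSucc.succ = D i := by
      ext k
      simp only [M, Matrix.of_apply, Fin.cons_succ, Fin.snoc_castSucc]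
    rw [hL, this]
    apply Matrix.det_zero_of_row_eq (i := 0) (j := i.castSucc.succ) (Fin.succ_ne_zero _).symm
    ext k
    simp only [r, Matrix.of_apply, Fin.cons_succ, Fin.snoc_castSucc, Fin.cons_zero]
  simp only [e5, mul_zero, Finset.sum_const_zero, zero_add] at h2
  rw [e1, e2, e3, e4, hL, hL, hL] at h2
  exact h2.symm

lemma plucker {n : ℕ} (a d x y : Fin (n+2) → ℂ) (D : Fin n → Fin (n+2) → ℂ) :
  Matrix.det (Matrix.of (Fin.cons a (Fin.snoc D y) : Fin (n+2) → Fin (n+2) → ℂ)) *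
  Matrix.det (Matrix.of (Fin.cons d (Fin.snoc D x) : Fin (n+2) → Fin (n+2) → ℂ)) -
  Matrix.det (Matrix.of (Fin.cons d (Fin.snoc D y) : Fin (n+2) → Fin (n+2) → ℂ)) *
  Matrix.det (Matrix.of (Fin.cons a (Fin.snoc D x) : Fin (n+2) → Fin (n+2) → ℂ)) =
  - (Matrix.det (Matrix.of (Fin.snoc (Fin.snoc D x : Fin (n+1) → Fin (n+2) → ℂ) y : Fin (n+2) → Fin (n+2) → ℂ)) *
  Matrix.det (Matrix.of (Fin.cons a (Fin.cons d D) : Fin (n+2) → Fin (n+2) → ℂ))) := by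
  rw [plucker0, rot, add_sub_cancel_left]
  have : Matrix.det (Matrix.of (Fin.cons a (Fin.snoc D d) : Fin (n+2) → Fin (n+2) → ℂ)) = (-1)^n * Matrix.det (Matrix.of (Fin.cons a (Fin.cons d D) : Fin (n+2) → Fin (n+2) → ℂ)) := by
    have h := Matrix.det_permute (Equiv.Perm.decomposeFin.symm (0, finRotate (n+1))) (Matrix.of (Fin.cons a (Fin.cons d D) : Fin (n+2) → Fin (n+2) → ℂ))
    rw [Equiv.Perm.decomposeFin.symm_sign, sign_finRotate] at h
    simp only [if_true, one_mul] at h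
    refine Eq.trans ?_ (h.trans (by simp))
    congr 1
    ext i j
    refine Fin.cases ?_ (fun i => ?_) i
    · simp
    · rw [Fin.snoc_eq_cons_rotate]
      simp
  rw [this]
  ring

def KK {N : ℕ} (v : ℤ → Fin N → ℂ) (s : ℤ) : ℂ := Matrix.det (Matrix.of fun j : Fin N => v (s + (j.1:ℤ)))

lemma KK_pred {n : ℕ} (b : ℂ) (F f : ℤ → Fin (n+1) → ℂ) (hf : ∀ j, f j = F j + b • F (j-1)) (s : ℤ) :
   KK F s = Matrix.det (Matrix.of (Fin.cons (F s) (fun j : Fin n => f (s+1+j)) : Fin (n+1) → Fin (n+1) → ℂ)) := by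
  apply Matrix.det_eq_of_forall_row_eq_smul_add_pred (fun _ => -b)
  · intro j; simp
  · intro i j
    simp only [Matrix.of_apply, Fin.cons_succ, hf, Fin.val_succ, Fin.val_castSucc, Pi.add_apply, Pi.smul_apply, smul_eq_mul]
    push_cast
    rw [show s + ((i:ℤ)+1) = s+1+i by ring, show s+1+(i:ℤ)-1 = s+i by ring]
    ring

lemma det_succ_op {n : ℕ} (c : Fin n → ℂ) (A B : Matrix (Fin (n+1)) (Fin (n+1)) ℂ)
    (h0 : ∀ j, A (Fin.last n) j = B (Fin.last n) j)
    (h1 : ∀ i j, A (Fin.castSucc i) j = B (Fin.castSucc i) j + c i * A i.succ j) : A.det = B.det := by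
  have := Matrix.det_eq_of_forall_row_eq_smul_add_pred (A := A.submatrix Fin.revPerm id) (B := B.submatrix Fin.revPerm id) (fun i => c i.rev)
    (by intro j; simpa using h0 j)
    (by intro i j; simpa [Fin.rev_succ, Fin.rev_castSucc] using h1 i.rev j)
  rw [Matrix.det_permute, Matrix.det_permute] at this
  refine mul_left_cancel₀ ?_ this
  simp

lemma KK_succ {n : ℕ} (c : ℂ) (f g : ℤ → Fin (n+1) → ℂ) (hg : ∀ j, g j = f j - c • f (j+1)) (s : ℤ) :
   KK f s = Matrix.det (Matrix.of (Fin.snoc (fun j : Fin n => g (s+j)) (f (s+n)) : Fin (n+1) → Fin (n+1) → ℂ)) := by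
  apply det_succ_op (fun _ => c)
  · intro j; simp
  · intro i j
    simp only [Matrix.of_apply, Fin.snoc_castSucc, hg, Fin.val_succ, Fin.val_castSucc, Pi.sub_apply, Pi.smul_apply, smul_eq_mul]
    push_cast
    rw [show s + ((i:ℤ)+1) = s+i+1 by ring]
    ring

lemma KK_minus {n : ℕ} (b : ℂ) (F f : ℤ → Fin (n+2) → ℂ) (hf : ∀ j, f j = F j + b • F (j-1)) (s : ℤ) :
   b * KK F (s-1) = -Matrix.det (Matrix.of (Fin.cons (F s) (Fin.cons (f s) (fun j : Fin n => f (s+1+j))) : Fin (n+2) → Fin (n+2) → ℂ)) := by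
  rw [KK_pred b F f hf]
  have h1 : (fun j : Fin (n+1) => f (s-1+1+j)) = Fin.cons (f s) (fun j : Fin n => f (s+1+j)) := by
    ext i j
    refine Fin.cases ?_ (fun i => ?_) i
    · simp
    · simp only [Fin.cons_succ, Fin.val_succ]; push_cast; ring_nf
  rw [h1]
  set E : Fin (n+1) → Fin (n+2) → ℂ := Fin.cons (f s) (fun j : Fin n => f (s+1+j)) with hE
  have h := (Matrix.detRowAlternating (n := Fin (n+2)) (R := ℂ)).toMultilinearMap.cons_smul E b (F (s-1))
  have h' : b • F (s-1) = f s - F s := by rw [hf s]; simp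
  rw [h'] at h
  have h2 := sub_cons (f s) (F s) E
  have h3 : Matrix.det (Matrix.of (Fin.cons (f s) E) : Matrix (Fin (n+2)) (Fin (n+2)) ℂ) = 0 := by
    apply Matrix.det_zero_of_row_eq (i := 0) (j := 1) (by simp)
    rfl
  rw [h3, zero_sub] at h2
  exact h.symm.trans h2

lemma split {n : ℕ} (g : ℤ → Fin (n+2) → ℂ) (x y : Fin (n+2) → ℂ) (s : ℤ) :
   (Fin.snoc (fun j : Fin (n+1) => g (s+j)) x : Fin (n+2) → Fin (n+2) → ℂ) = Fin.cons (g s) (Fin.snoc (fun j : Fin n => g (s+1+j)) x) := by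
  rw [Fin.cons_snoc_eq_snoc_cons]
  congr 1
  ext i j
  refine Fin.cases ?_ (fun i => ?_) i
  · simp
  · simp only [Fin.cons_succ, Fin.val_succ]; push_cast; ring_nf

lemma split2 {n N : ℕ} (g : ℤ → Fin N → ℂ) (s : ℤ) :
   (fun j : Fin (n+1) => g (s+j)) = Fin.snoc (fun j : Fin n => g (s+j)) (g (s+n)) := by
  ext i j
  refine Fin.lastCases ?_ (fun i => ?_) i
  · simp
  · simp

lemma todaA {n : ℕ} (b : ℂ) (F f : ℤ → Fin (n+2) → ℂ) (hf : ∀ j, f j = F j + b • F (j-1)) (e : Fin (n+2) → ℂ) (s : ℤ) :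
   Matrix.det (Matrix.of (Fin.snoc (fun j : Fin (n+1) => F (s+j)) e : Fin (n+2) → Fin (n+2) → ℂ)) * KK f s
   - Matrix.det (Matrix.of (Fin.snoc (fun j : Fin (n+1) => f (s+j)) e : Fin (n+2) → Fin (n+2) → ℂ)) * KK F s
   = b * Matrix.det (Matrix.of (Fin.snoc (fun j : Fin (n+1) => f (s+1+j)) e : Fin (n+2) → Fin (n+2) → ℂ)) * KK F (s-1) := by
  have hF : Matrix.det (Matrix.of (Fin.snoc (fun j : Fin (n+1) => F (s+j)) e : Fin (n+2) → Fin (n+2) → ℂ)) = Matrix.det (Matrix.of (Fin.cons (F s) (Fin.snoc (fun j : Fin n => f (s+1+j)) e) : Fin (n+2) → Fin (n+2) → ℂ)) := by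
    rw [split _ _ e]
    apply Matrix.det_eq_of_forall_row_eq_smul_add_pred (Fin.snoc (fun _ => -b) 0)
    · intro j; simp
    · intro i j
      refine Fin.lastCases ?_ (fun i => ?_) i
      · simp
      · have : (Fin.cons (F s) (Fin.snoc (fun j : Fin n => F (s+1+j)) e) : Fin (n+2) → Fin (n+2) → ℂ) i.castSucc.castSucc = F (s+i) := by
          rw [← split _ _ e]; simp
        simp only [Matrix.of_apply, Fin.cons_succ, Fin.snoc_castSucc, this, hf, Pi.add_apply, Pi.smul_apply, smul_eq_mul]
        rw [show s+1+(i:ℤ)-1 = s+i by ring]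
        ring
  have hKf : KK f s = Matrix.det (Matrix.of (Fin.cons (f s) (Fin.snoc (fun j : Fin n => f (s+1+j)) (f (s+1+n))) : Fin (n+2) → Fin (n+2) → ℂ)) := by
    rw [← split _ _ e]; unfold KK; rw [split2]; push_cast; rw [show s+((n:ℤ)+1) = s+1+n by ring]
  have hKF : KK F s = Matrix.det (Matrix.of (Fin.cons (F s) (Fin.snoc (fun j : Fin n => f (s+1+j)) (f (s+1+n))) : Fin (n+2) → Fin (n+2) → ℂ)) := by
    rw [KK_pred b F f hf, split2]
  have hm := KK_minus b F f hf s
  rw [mul_right_comm, hm, hF, hKf, hKF, split _ _ e, split2 f (s+1), plucker]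
  ring

lemma todaB {n : ℕ} (b c : ℂ) (F f G g : ℤ → Fin (n+2) → ℂ) (hf : ∀ j, f j = F j + b • F (j-1))
   (hG : ∀ j, G j = F j - c • F (j+1)) (hg : ∀ j, g j = f j - c • f (j+1)) (s : ℤ) :
   (1 + c * b) * KK F s * KK g s - KK f s * KK G s = c * b * KK f (s+1) * KK G (s-1) := by
  have hgG : ∀ j, g j = G j + b • G (j-1) := by
    intro j; ext i; simp only [hg, hf, hG, Pi.add_apply, Pi.sub_apply, Pi.smul_apply, smul_eq_mul, add_sub_cancel_right, sub_add_cancel]; ring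
  have hKg : KK g s = Matrix.det (Matrix.of (Fin.cons (g s) (Fin.snoc (fun j : Fin n => g (s+1+j)) (g (s+1+n))) : Fin (n+2) → Fin (n+2) → ℂ)) := by
    rw [← split _ _ 0]; unfold KK; rw [split2]; push_cast; rw [show s+((n:ℤ)+1) = s+1+n by ring]
  have hKG : KK G s = Matrix.det (Matrix.of (Fin.cons (G s) (Fin.snoc (fun j : Fin n => g (s+1+j)) (g (s+1+n))) : Fin (n+2) → Fin (n+2) → ℂ)) := by
    rw [KK_pred b G g hgG, split2]
  have hKf : KK f s = Matrix.det (Matrix.of (Fin.cons (g s) (Fin.snoc (fun j : Fin n => g (s+1+j)) (f (s+1+n))) : Fin (n+2) → Fin (n+2) → ℂ)) := by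
    rw [KK_succ c f g hg, split _ _ 0]; push_cast; rw [show s+((n:ℤ)+1) = s+1+n by ring]
  have hm := KK_minus b G g hgG s
  have hKf1 : c * KK f (s+1) = Matrix.det (Matrix.of (Fin.snoc (Fin.snoc (fun j : Fin n => g (s+1+j)) (g (s+1+n)) : Fin (n+1) → Fin (n+2) → ℂ) (f (s+1+n)) : Fin (n+2) → Fin (n+2) → ℂ)) := by
    rw [KK_succ c f g hg, split2]
    set E : Fin (n+1) → Fin (n+2) → ℂ := Fin.snoc (fun j : Fin n => g (s+1+j)) (g (s+1+n)) with hE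
    rw [rot, rot]
    have h := (Matrix.detRowAlternating (n := Fin (n+2)) (R := ℂ)).toMultilinearMap.cons_smul E c (f (s+1+n+1))
    have h' : c • f (s+1+n+1) = f (s+1+n) - g (s+1+n) := by rw [hg]; simp
    rw [h'] at h
    have h2 := sub_cons (f (s+1+n)) (g (s+1+n)) E
    have h3 : Matrix.det (Matrix.of (Fin.cons (g (s+1+n)) E) : Matrix (Fin (n+2)) (Fin (n+2)) ℂ) = 0 := by
      apply Matrix.det_zero_of_row_eq (i := 0) (j := (Fin.last n).succ) (Fin.succ_ne_zero _).symm
      ext k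
      rw [Matrix.of_apply, Matrix.of_apply]
      simp [E]
    rw [h3, sub_zero] at h2
    have h4 := h.symm.trans h2
    push_cast
    rw [show s+1+((n:ℤ)+1) = s+1+n+1 by ring, ← h4]
    simp only [smul_eq_mul]
    rw [mul_left_comm]; rfl
  have hKF : (1 + c*b) * KK F s = Matrix.det (Matrix.of (Fin.cons (G s) (Fin.snoc (fun j : Fin n => g (s+1+j)) (f (s+1+n))) : Fin (n+2) → Fin (n+2) → ℂ)) := by
    rw [KK_pred b F f hf]
    set E : Fin (n+1) → Fin (n+2) → ℂ := fun j : Fin (n+1) => f (s+1+j) with hE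
    have h := (Matrix.detRowAlternating (n := Fin (n+2)) (R := ℂ)).toMultilinearMap.cons_smul E (1+c*b) (F s)
    have h5 := (Matrix.detRowAlternating (n := Fin (n+2)) (R := ℂ)).toMultilinearMap.cons_smul E c (f (s+1))
    have h' : G s = (1+c*b) • F s - c • f (s+1) := by
      rw [hG, hf]; ext i; simp; ring
    have h2 := sub_cons ((1+c*b) • F s) (c • f (s+1)) E
    rw [← h'] at h2
    have h3 : Matrix.det (Matrix.of (Fin.cons (f (s+1)) E) : Matrix (Fin (n+2)) (Fin (n+2)) ℂ) = 0 := by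
      apply Matrix.det_zero_of_row_eq (i := 0) (j := 1) (by simp)
      ext k
      rw [Matrix.of_apply, Matrix.of_apply, ← Fin.succ_zero_eq_one, Fin.cons_succ]
      simp [E]
    have h6 : Matrix.det (Matrix.of (Fin.cons (c • f (s+1)) E) : Matrix (Fin (n+2)) (Fin (n+2)) ℂ) = 0 := by
      refine Eq.trans h5 ?_
      refine Eq.trans (congrArg _ h3) ?_
      simp
    rw [h6, sub_zero] at h2
    refine (h.symm.trans h2.symm).trans ?_
    apply det_succ_op (Fin.cons 0 (fun _ => c))
    · intro j
      rw [Matrix.of_apply, Matrix.of_apply, ← Fin.succ_last, Fin.cons_succ, Fin.cons_succ]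
      simp [E]
    · intro i j
      refine Fin.cases ?_ (fun i => ?_) i
      · simp
      · simp only [Matrix.of_apply, ← Fin.succ_castSucc, Fin.cons_succ, Fin.snoc_castSucc, hg, E, Fin.val_succ, Fin.val_castSucc, Pi.sub_apply, Pi.smul_apply, smul_eq_mul]
        push_cast
        rw [show s + 1 + ((i:ℤ)+1) = s+1+i+1 by ring]
        ring
  have : c * b * KK f (s+1) * KK G (s-1) = (c * KK f (s+1)) * (b * KK G (s-1)) := by ring
  rw [this, hm, hKf1, hKF, hKg, hKf, hKG, plucker]
  ring

lemma laplace {N : ℕ} (v : Fin N → ℕ → ℂ) :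
  Matrix.det (Matrix.of (Fin.snoc (fun j : Fin N => fun i : Fin (N+1) => v j i.1) (Pi.single (Fin.last N) 1) : Fin (N+1) → Fin (N+1) → ℂ)) = Matrix.det (Matrix.of fun j i : Fin N => v j i.1) := by
  rw [Matrix.det_succ_row _ (Fin.last N), Finset.sum_eq_single (Fin.last N)]
  · have : (-1:ℂ)^(N+N) = 1 := by rw [← two_mul]; simp
    simp [this]
    congr 1
    ext i j
    simp
  · intro i _ hi; simp [hi]
  · simp

lemma mainB (b c : ℂ) (F f G g : ℤ → ℕ → ℂ) (hf : ∀ j i, f j i = F j i + b * F (j-1) i)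
   (hG : ∀ j i, G j i = F j i - c * F (j+1) i) (hg : ∀ j i, g j i = f j i - c * f (j+1) i) (s : ℤ)
   (N : ℕ) :
   (1 + c * b) * KK (fun j (i : Fin N) => F j i) s * KK (fun j (i : Fin N) => g j i) s
    - KK (fun j (i : Fin N) => f j i) s * KK (fun j (i : Fin N) => G j i) s
    = c * b * KK (fun j (i : Fin N) => f j i) (s+1) * KK (fun j (i : Fin N) => G j i) (s-1) := by
  match N with
  | 0 => simp [KK]
  | 1 =>
    simp [KK, hG, hg, hf]
    ring
  | n+2 =>
    apply todaB
    · intro j; ext i; simp [hf]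
    · intro j; ext i; simp [hG]
    · intro j; ext i; simp [hg]

lemma mainA (b : ℂ) (F f : ℤ → ℕ → ℂ) (hf : ∀ j i, f j i = F j i + b * F (j-1) i) (s : ℤ)
   (N : ℕ) :
   KK (fun j (i : Fin N) => F j i) s * KK (fun j (i : Fin (N+1)) => f j i) s
    - KK (fun j (i : Fin N) => f j i) s * KK (fun j (i : Fin (N+1)) => F j i) s
    = b * KK (fun j (i : Fin N) => f j i) (s+1) * KK (fun j (i : Fin (N+1)) => F j i) (s-1) := by
  match N with
  | 0 => simp [KK, hf]
  | n+1 =>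
    have h := todaA b (fun j (i : Fin (n+2)) => F j i) (fun j (i : Fin (n+2)) => f j i)
      (by intro j; ext i; simp [hf]) (Pi.single (Fin.last (n+1)) 1) s
    rw [laplace (fun j => F (s+j)), laplace (fun j => f (s+j)), laplace (fun j => f (s+1+j))] at h
    exact h

/-- The molecule-type Casorati determinant `κ`, whose size `l₁` is itself one of the discrete
independent variables, satisfies the bilinear discrete two-dimensional Toda lattice equations
in the direction `l₁` (with coefficient `b`) and in the directions `l₂, l₃` (with coefficients
involving `c₂, c₃`). The functions `φ₁, φ₂, φ₃, …` are indexed by integers `i ≥ 1`. -/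
theorem stmt_4 (b : ℂ) (c₂ c₃ : ℤ → ℂ)
    (φ : ℕ → ℤ → ℤ → ℤ → ℤ → ℂ)
    (hφ2 : ∀ i : ℕ, 1 ≤ i → ∀ l₂ l₃ m s : ℤ,
      φ i (l₂+1) l₃ m s - φ i l₂ l₃ m s = -(c₂ l₂) * φ i l₂ l₃ m (s+1))
    (hφ3 : ∀ i : ℕ, 1 ≤ i → ∀ l₂ l₃ m s : ℤ,
      φ i l₂ (l₃+1) m s - φ i l₂ l₃ m s = -(c₃ l₃) * φ i l₂ l₃ m (s+1))
    (hφm : ∀ i : ℕ, 1 ≤ i → ∀ l₂ l₃ m s : ℤ,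
      φ i l₂ l₃ m s - φ i l₂ l₃ (m-1) s = -b * φ i l₂ l₃ m (s-1))
    (κ : ℕ → ℤ → ℤ → ℤ → ℤ → ℂ)
    (hκ : ∀ (l₁ : ℕ) (l₂ l₃ m s : ℤ),
      κ l₁ l₂ l₃ m s
        = Matrix.det (Matrix.of fun i j : Fin l₁ => φ (i.1 + 1) l₂ l₃ m (s + (j.1 : ℤ)))) :
    ∀ (l₁ : ℕ) (l₂ l₃ m s : ℤ),
      (κ l₁ l₂ l₃ (m+1) s * κ (l₁+1) l₂ l₃ m s - κ l₁ l₂ l₃ m s * κ (l₁+1) l₂ l₃ (m+1) s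
          = b * κ l₁ l₂ l₃ m (s+1) * κ (l₁+1) l₂ l₃ (m+1) (s-1))
      ∧ ((1 + c₂ l₂ * b) * κ l₁ l₂ l₃ (m+1) s * κ l₁ (l₂+1) l₃ m s
            - κ l₁ l₂ l₃ m s * κ l₁ (l₂+1) l₃ (m+1) s
          = c₂ l₂ * b * κ l₁ l₂ l₃ m (s+1) * κ l₁ (l₂+1) l₃ (m+1) (s-1))
      ∧ ((1 + c₃ l₃ * b) * κ l₁ l₂ l₃ (m+1) s * κ l₁ l₂ (l₃+1) m s
            - κ l₁ l₂ l₃ m s * κ l₁ l₂ (l₃+1) (m+1) s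
          = c₃ l₃ * b * κ l₁ l₂ l₃ m (s+1) * κ l₁ l₂ (l₃+1) (m+1) (s-1)) := by
  have hK : ∀ (l₁ : ℕ) (l₂ l₃ m s : ℤ),
      κ l₁ l₂ l₃ m s = KK (fun j (i : Fin l₁) => φ (i.1+1) l₂ l₃ m j) s := by
    intro l₁ l₂ l₃ m s
    rw [hκ, ← Matrix.det_transpose]
    rfl
  intro l₁ l₂ l₃ m s
  have hf : ∀ l₂ l₃ (j : ℤ) (i : ℕ), φ (i+1) l₂ l₃ m j
      = φ (i+1) l₂ l₃ (m+1) j + b * φ (i+1) l₂ l₃ (m+1) (j-1) := by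
    intro l₂ l₃ j i
    have := hφm (i+1) (by omega) l₂ l₃ (m+1) j
    rw [add_sub_cancel_right] at this
    linear_combination -this
  simp only [hK]
  refine ⟨?_, ?_, ?_⟩
  · exact mainA b (fun j i => φ (i+1) l₂ l₃ (m+1) j) (fun j i => φ (i+1) l₂ l₃ m j) (hf l₂ l₃) s l₁
  · refine mainB b (c₂ l₂) (fun j i => φ (i+1) l₂ l₃ (m+1) j) (fun j i => φ (i+1) l₂ l₃ m j)
      (fun j i => φ (i+1) (l₂+1) l₃ (m+1) j) (fun j i => φ (i+1) (l₂+1) l₃ m j) (hf l₂ l₃) ?_ ?_ s l₁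
    · intro j i; linear_combination hφ2 (i+1) (by omega) l₂ l₃ (m+1) j
    · intro j i; linear_combination hφ2 (i+1) (by omega) l₂ l₃ m j
  · refine mainB b (c₃ l₃) (fun j i => φ (i+1) l₂ l₃ (m+1) j) (fun j i => φ (i+1) l₂ l₃ m j)
      (fun j i => φ (i+1) l₂ (l₃+1) (m+1) j) (fun j i => φ (i+1) l₂ (l₃+1) m j) (hf l₂ l₃) ?_ ?_ s l₁
    · intro j i; linear_combination hφ3 (i+1) (by omega) l₂ l₃ (m+1) j
    · intro j i; linear_combination hφ3 (i+1) (by omega) l₂ l₃ m j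
end

section
/- Let N ≥ 1, b ∈ ℂ, a₁,a₂ : ℤ → ℂ, and for i = 1,…,N let pᵢ, Aᵢ, Bᵢ ∈ ℂ with pᵢ ≠ 0 and pᵢ + b ≠ 0, and set qᵢ = −pᵢ − b. Assume 1 − a_k(l)pᵢ ≠ 0 and 1 − a_k(l)qᵢ ≠ 0 for all l ∈ ℤ, k = 1,2 and all i. Let P_{i,k}, Q_{i,k} : ℤ → ℂ (k = 1,2) satisfy (1 − a_k(l)pᵢ)·P_{i,k}(l+1) = P_{i,k}(l) and (1 − a_k(l)qᵢ)·Q_{i,k}(l+1) = Q_{i,k}(l) for all l ∈ ℤ. Define φᵢ(l₁,l₂,s) = Aᵢ·pᵢ^s·P_{i,1}(l₁)·P_{i,2}(l₂) + Bᵢ·qᵢ^s·Q_{i,1}(l₁)·Q_{i,2}(l₂) (integer powers of nonzero pᵢ, qᵢ), and σ(l₁,l₂,s) = det( φᵢ(l₁,l₂,s+j−1) )_{i,j=1,…,N}. Then for k = 1,2 and all (l₁,l₂,s) ∈ ℤ³: (1+a_k(l_k)b)·σ(l+e_k, s+2)·σ(l, s) − σ(l+e_k, s)·σ(l, s+2)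 = a_k(l_k)·b·σ(l+e_k, s+1)·σ(l, s+1), where l = (l₁,l₂) and e_k is the k-th unit vector. -/
abbrev snocRow {n m : ℕ} (M : Fin n → Fin m → ℂ) (u : Fin m → ℂ) : Fin (n+1) → Fin m → ℂ :=
  Fin.snoc (α := fun _ => Fin m → ℂ) M u

theorem pluck_aux {N : ℕ} (M : Fin N → Fin (N+2) → ℂ) (u v r s : Fin (N+2) → ℂ)
    (B : (Fin (N+2) → ℂ) → (Fin (N+2) → ℂ) → ℂ)
    (hB : ∀ u v, B u v = Matrix.det (Matrix.of (snocRow (snocRow M u) v))) :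
    B u v * B r s = B r v * B u s + B u r * B v s := by
  obtain ⟨A, hA⟩ : ∃ A : Matrix (Fin (N+2)) (Fin (N+2)) ℂ,
    A = Matrix.of (snocRow (snocRow M u) v) := ⟨_, rfl⟩
  have key : A.det • r = ∑ i, (A.updateRow i r).det • A i := by
    rw [← Matrix.det_transpose, ← Matrix.mulVec_cramer]
    ext j
    simp only [Matrix.mulVec, dotProduct, Matrix.cramer_transpose_apply, Matrix.transpose_apply,
      Finset.sum_apply, Pi.smul_apply, smul_eq_mul]
    exact Finset.sum_congr rfl fun i _ => mul_comm _ _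
  let L : (Fin (N+2) → ℂ) →ₗ[ℂ] ℂ :=
    (Matrix.detRowAlternating (n := Fin (N+2)) (R := ℂ)).toMultilinearMap.toLinearMap
      (snocRow (snocRow M 0) s) (Fin.last N).castSucc
  have up1 : ∀ (M : Fin (N+1) → Fin (N+2) → ℂ) (u v : Fin (N+2) → ℂ),
      Function.update (snocRow M u) (Fin.last (N+1)) v = snocRow M v := by
    intro M u v
    exact Fin.update_snoc_last (α := fun _ => _) _ _ _
  have up2 : ∀ (M : Fin N → Fin (N+2) → ℂ) (u v w : Fin (N+2) → ℂ),
      Function.update (snocRow (snocRow M u) w) (Fin.last N).castSucc v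
        = snocRow (snocRow M v) w := by
    intro M u v w
    rw [snocRow, ← Fin.snoc_update, Fin.update_snoc_last]
  have hL : ∀ w, L w = B w s := by
    intro w
    rw [hB]
    exact congrArg Matrix.det (up2 M 0 w s)
  have h := congrArg L key
  rw [map_smul, map_sum, Fin.sum_univ_castSucc, Fin.sum_univ_castSucc] at h
  simp only [map_smul] at h
  simp only [hL, smul_eq_mul] at h
  have e1 : A.det = B u v := by rw [hB, hA]
  have e2 : (A.updateRow (Fin.last (N+1)) r).det = B u r := by
    rw [hB, hA]
    exact congrArg Matrix.det (up1 _ v r)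
  have e3 : (A.updateRow (Fin.last N).castSucc r).det = B r v := by
    rw [hB, hA]
    exact congrArg Matrix.det (up2 M u r v)
  have g1 : ∀ (M : Fin N → Fin (N+2) → ℂ) (u v : Fin (N+2) → ℂ) (i : Fin N),
      Matrix.of (snocRow (snocRow M u) v) i.castSucc.castSucc = M i := by
    intro M u v i
    change snocRow (snocRow M u) v i.castSucc.castSucc = M i
    simp [snocRow]
  have g2 : ∀ (M : Fin N → Fin (N+2) → ℂ) (u v : Fin (N+2) → ℂ),
      Matrix.of (snocRow (snocRow M u) v) (Fin.last N).castSucc = u := by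
    intro M u v
    change snocRow (snocRow M u) v (Fin.last N).castSucc = u
    simp [snocRow]
  have e4 : A (Fin.last (N+1)) = v := by
    rw [hA]
    change snocRow (snocRow M u) v (Fin.last (N+1)) = v
    simp [snocRow]
  have e5 : A (Fin.last N).castSucc = u := by
    rw [hA, g2]
  have e6 : ∀ i : Fin N, B (A i.castSucc.castSucc) s = 0 := by
    intro i
    rw [hB]
    apply Matrix.det_zero_of_row_eq (i := i.castSucc.castSucc) (j := (Fin.last N).castSucc)
    · intro h
      have := congrArg Fin.val h
      simp at this
      have := i.2
      omega
    · rw [g1, g2, hA, g1]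
  rw [e1, e2, e3, e4, e5] at h
  simp only [e6, mul_zero, Finset.sum_const_zero, zero_add] at h
  exact h

theorem border_aux {n : ℕ} (X : Fin n → ℕ → ℂ) (u v : ℂ) :
    Matrix.det (Matrix.of (snocRow (fun i j => X i j)
      (fun j : Fin (n+1) => u ^ (j:ℕ) * v ^ (n - (j:ℕ)))))
    = Matrix.det (Matrix.of fun i j : Fin n => u * X i j - v * X i (j+1)) := by
  by_cases hv : v = 0
  · subst hv
    rw [Matrix.det_succ_row _ (Fin.last n), Fin.sum_univ_castSucc]
    have : (Matrix.of fun i j : Fin n => u * X i j - 0 * X i (j+1)) =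
      u • (Matrix.of fun i j : Fin n => X i j) := by
      ext i j; simp
    rw [this, Matrix.det_smul]
    simp only [Matrix.of_apply, snocRow, Fin.snoc_last]
    rw [Finset.sum_eq_zero]
    · have : ((Matrix.of (snocRow (fun i j => X i j)
        (fun j : Fin (n+1) => u ^ (j:ℕ) * 0 ^ (n - (j:ℕ))))).submatrix (Fin.last n).succAbove
          (Fin.last n).succAbove) = (Matrix.of fun i j : Fin n => X i j) := by
        ext i j
        simp [snocRow]
      rw [snocRow] at this
      rw [this]
      simp [← two_mul]
    · intro i _
      have : n - (i.castSucc : ℕ) ≠ 0 := by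
        have := i.2
        simp
        omega
      simp only [zero_pow this]
      simp
  · rw [Matrix.det_eq_of_forall_col_eq_smul_add_pred
      (B := Matrix.of (snocRow (fun i => Fin.cons (α := fun _ => ℂ) (X i 0)
        (fun j : Fin n => X i (j+1) - u / v * X i j)) (Fin.cons (α := fun _ => ℂ) (v^n)
        (fun j : Fin n => 0)))) (fun _ => u / v)]
    · rw [Matrix.det_succ_row _ (Fin.last n), Fin.sum_univ_succ]
      have : (Matrix.of fun i j : Fin n => u * X i j - v * X i (j+1)) =
        (-v) • (Matrix.of fun i j : Fin n => X i (j+1) - u / v * X i j) := by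
        ext i j; simp; field_simp; ring
      rw [this, Matrix.det_smul]
      simp only [Matrix.of_apply, snocRow, Fin.snoc_last]
      rw [Finset.sum_eq_zero]
      · have : ((Matrix.of (snocRow (fun i => Fin.cons (α := fun _ => ℂ) (X i 0)
          (fun j : Fin n => X i (j+1) - u / v * X i j)) (Fin.cons (α := fun _ => ℂ) (v^n)
          (fun j : Fin n => 0)))).submatrix (Fin.last n).succAbove
            (Fin.succAbove 0)) = (Matrix.of fun i j : Fin n => X i (j+1) - u / v * X i j) := by
          ext i j
          simp [snocRow]
        rw [snocRow] at this
        rw [this]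
        simp
        rw [neg_pow v]
        simp
      · intro i _
        simp
    · intro i
      refine Fin.lastCases ?_ (fun i => ?_) i
      · simp [snocRow]
      · simp [snocRow]
    · intro i j
      refine Fin.lastCases ?_ (fun i => ?_) i
      · simp [snocRow]
        have : n - (j:ℕ) = (n - (j+1)) + 1 := by
          have := j.2
          omega
        rw [this, pow_succ, pow_succ]
        field_simp
      · simp [snocRow]

def LL (u v : ℂ) (x : ℕ → ℂ) : ℕ → ℂ := fun j => u * x j - v * x (j+1)

def ee (n : ℕ) (u v : ℂ) : Fin (n+1) → ℂ := fun j => u ^ (j:ℕ) * v ^ (n - (j:ℕ))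

def WW {N : ℕ} (X : Fin N → ℕ → ℂ) (u v u' v' : ℂ) : ℂ :=
  Matrix.det (Matrix.of fun i j : Fin N => LL u v (LL u' v' (X i)) j)

theorem border2 {N : ℕ} (X : Fin N → ℕ → ℂ) (u v u' v' : ℂ) :
    Matrix.det (Matrix.of (snocRow (snocRow (fun i j => X i j) (ee (N+1) u v)) (ee (N+1) u' v')))
    = (u' * v - v' * u) * WW X u v u' v' := by
  have h := border_aux (n := N+1) (Fin.snoc (α := fun _ => ℕ → ℂ) X
    (fun j => u ^ j * v ^ (N+1-j))) u' v'
  have e : (snocRow (snocRow (fun i j => X i j) (ee (N+1) u v)) (ee (N+1) u' v'))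
      = snocRow (fun (i : Fin (N+1)) (j : Fin (N+2)) => (Fin.snoc (α := fun _ => ℕ → ℂ) X
    (fun j => u ^ j * v ^ (N+1-j))) i (j:ℕ)) (fun j => u' ^ (j:ℕ) * v' ^ (N+1 - (j:ℕ))) := by
    have : (snocRow (fun i (j : Fin (N+2)) => X i j) (ee (N+1) u v)) =
      (fun (i : Fin (N+1)) (j : Fin (N+2)) => (Fin.snoc (α := fun _ => ℕ → ℂ) X
    (fun j => u ^ j * v ^ (N+1-j))) i (j:ℕ)) := by
      ext i j
      refine Fin.lastCases ?_ (fun i => ?_) i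
      · simp [snocRow, ee]
      · simp [snocRow]
    rw [this]
    rfl
  rw [e, h]
  have h2 := border_aux (fun i => LL u' v' (X i)) u v
  rw [WW]
  change _ = _ * Matrix.det (Matrix.of fun i j : Fin N => u * LL u' v' (X i) j - v * LL u' v' (X i) (j+1))
  rw [← h2]
  have h3 := Matrix.det_updateRow_smul (Matrix.of (snocRow (fun i (j : Fin (N+1)) => LL u' v' (X i) j)
      (fun j : Fin (N+1) => u ^ (j:ℕ) * v ^ (N - (j:ℕ))))) (Fin.last N) (u' * v - v' * u)
      (fun j : Fin (N+1) => u ^ (j:ℕ) * v ^ (N - (j:ℕ)))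
  have e4 : ∀ w, (Matrix.of (snocRow (fun i (j : Fin (N+1)) => LL u' v' (X i) j)
      (fun j : Fin (N+1) => u ^ (j:ℕ) * v ^ (N - (j:ℕ))))).updateRow (Fin.last N) w
      = Matrix.of (snocRow (fun i (j : Fin (N+1)) => LL u' v' (X i) j) w) := by
    intro w
    exact Fin.update_snoc_last (α := fun _ => Fin (N+1) → ℂ) (fun j : Fin (N+1) => u ^ (j:ℕ) * v ^ (N - (j:ℕ)))
      (fun i (j : Fin (N+1)) => LL u' v' (X i) j) w
  rw [e4, e4] at h3
  rw [← h3]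
  congr 1
  ext i j
  refine Fin.lastCases ?_ (fun i => ?_) i
  · simp [snocRow]
    have := j.2
    have : N + 1 - (j:ℕ) = N - j + 1 := by omega
    rw [this]
    ring
  · simp [snocRow, LL]

theorem hm {N : ℕ} (X : Fin N → ℕ → ℂ) (a b : ℂ) :
    (1 + a * b) * Matrix.det (Matrix.of fun i j : Fin N => X i (j+1)) *
        Matrix.det (Matrix.of fun i j : Fin N =>
          b * (X i j - a * X i (j+1)) + (X i (j+1) - a * X i (j+2)))
      - Matrix.det (Matrix.of fun i j : Fin N => b * X i j + X i (j+1)) *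
        Matrix.det (Matrix.of fun i j : Fin N => X i (j+1) - a * X i (j+2))
      = a * b * Matrix.det (Matrix.of fun i j : Fin N => b * X i (j+1) + X i (j+2)) *
        Matrix.det (Matrix.of fun i j : Fin N => X i j - a * X i (j+1)) := by
  have h := pluck_aux (fun i (j : Fin (N+2)) => X i j) (ee (N+1) 0 (-1)) (ee (N+1) 1 0)
    (ee (N+1) b (-1)) (ee (N+1) 1 a) _ (fun _ _ => rfl)
  simp only [border2] at h
  simp only [WW, LL] at h
  ring_nf at h ⊢
  linear_combination h

theorem core {N : ℕ} (x y : Fin N → ℤ → ℂ) (a b : ℂ) (c : Fin N → ℂ) (hc : ∀ i, c i ≠ 0)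
    (hx : ∀ i s, x i (s+2) + b * x i (s+1) = c i * x i s)
    (hy : ∀ i s, y i s = x i s - a * x i (s+1)) (s : ℤ) (τ σ : ℤ → ℂ)
    (hτ : ∀ s, τ s = Matrix.det (Matrix.of fun i j : Fin N => x i (s + (j.1 : ℤ))))
    (hσ : ∀ s, σ s = Matrix.det (Matrix.of fun i j : Fin N => y i (s + (j.1 : ℤ)))) :
    (1 + a * b) * τ (s+2) * σ s - τ s * σ (s+2) = a * b * τ (s+1) * σ (s+1) := by
  have hC : (∏ i, c i) ≠ 0 := Finset.prod_ne_zero_iff.2 fun i _ => hc i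
  have h := hm (fun i j => x i (s+1+(j:ℤ))) a b
  have d1 : Matrix.det (Matrix.of fun i j : Fin N => x i (s+1+((j+1 : ℕ):ℤ))) = τ (s+2) := by
    rw [hτ]; congr; ext i j; congr 1; push_cast; ring
  have d2 : Matrix.det (Matrix.of fun i j : Fin N =>
      x i (s+1+((j+1 : ℕ):ℤ)) - a * x i (s+1+((j+2 : ℕ):ℤ))) = σ (s+2) := by
    rw [hσ]; congr; ext i j; rw [hy]; push_cast; ring_nf
  have d3 : Matrix.det (Matrix.of fun i j : Fin N =>
      x i (s+1+((j : ℕ):ℤ)) - a * x i (s+1+((j+1 : ℕ):ℤ))) = σ (s+1) := by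
    rw [hσ]; congr; ext i j; rw [hy]; push_cast; ring_nf
  have d4 : Matrix.det (Matrix.of fun i j : Fin N =>
      b * x i (s+1+((j : ℕ):ℤ)) + x i (s+1+((j+1 : ℕ):ℤ))) = (∏ i, c i) * τ s := by
    rw [hτ, ← Matrix.det_mul_column]; congr; ext i j
    simp only [Matrix.of_apply]; rw [← hx]; push_cast; ring_nf
  have d5 : Matrix.det (Matrix.of fun i j : Fin N =>
      b * x i (s+1+((j+1 : ℕ):ℤ)) + x i (s+1+((j+2 : ℕ):ℤ))) = (∏ i, c i) * τ (s+1) := by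
    rw [hτ, ← Matrix.det_mul_column]; congr; ext i j
    simp only [Matrix.of_apply]; rw [← hx]; push_cast; ring_nf
  have d6 : Matrix.det (Matrix.of fun i j : Fin N =>
      b * (x i (s+1+((j : ℕ):ℤ)) - a * x i (s+1+((j+1 : ℕ):ℤ)))
        + (x i (s+1+((j+1 : ℕ):ℤ)) - a * x i (s+1+((j+2 : ℕ):ℤ)))) = (∏ i, c i) * σ s := by
    rw [hσ, ← Matrix.det_mul_column]; congr; ext i j
    simp only [Matrix.of_apply]
    have h1 := hx i (s+j)
    have h2 := hx i (s+j+1)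
    rw [hy]; push_cast
    ring_nf at h1 h2 ⊢
    linear_combination h1 - a * h2
  simp only [d1, d2, d3, d4, d5, d6] at h
  apply mul_left_cancel₀ hC
  linear_combination h



/-- The Casorati determinant built from soliton-type entries with the reduction condition
`qᵢ = -pᵢ - b` satisfies the bilinear equations of the discrete Schwarzian KdV equation. -/
theorem stmt_6 (N : ℕ) (hN : 1 ≤ N) (b : ℂ) (a₁ a₂ : ℤ → ℂ)
    (p A B : Fin N → ℂ) (hp : ∀ i, p i ≠ 0) (hpb : ∀ i, p i + b ≠ 0)
    (q : Fin N → ℂ) (hq : ∀ i, q i = -(p i) - b)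
    (hap : ∀ (i : Fin N) (l : ℤ), 1 - a₁ l * p i ≠ 0 ∧ 1 - a₂ l * p i ≠ 0)
    (haq : ∀ (i : Fin N) (l : ℤ), 1 - a₁ l * q i ≠ 0 ∧ 1 - a₂ l * q i ≠ 0)
    (P₁ P₂ Q₁ Q₂ : Fin N → ℤ → ℂ)
    (hP₁ : ∀ (i : Fin N) (l : ℤ), (1 - a₁ l * p i) * P₁ i (l+1) = P₁ i l)
    (hP₂ : ∀ (i : Fin N) (l : ℤ), (1 - a₂ l * p i) * P₂ i (l+1) = P₂ i l)
    (hQ₁ : ∀ (i : Fin N) (l : ℤ), (1 - a₁ l * q i) * Q₁ i (l+1) = Q₁ i l)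
    (hQ₂ : ∀ (i : Fin N) (l : ℤ), (1 - a₂ l * q i) * Q₂ i (l+1) = Q₂ i l)
    (φ : Fin N → ℤ → ℤ → ℤ → ℂ)
    (hφ : ∀ (i : Fin N) (l₁ l₂ s : ℤ),
      φ i l₁ l₂ s = A i * p i ^ s * P₁ i l₁ * P₂ i l₂ + B i * q i ^ s * Q₁ i l₁ * Q₂ i l₂)
    (σ : ℤ → ℤ → ℤ → ℂ)
    (hσ : ∀ l₁ l₂ s : ℤ,
      σ l₁ l₂ s = Matrix.det (Matrix.of fun i j : Fin N => φ i l₁ l₂ (s + (j.1 : ℤ)))) :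
    ∀ l₁ l₂ s : ℤ,
      ((1 + a₁ l₁ * b) * σ (l₁+1) l₂ (s+2) * σ l₁ l₂ s - σ (l₁+1) l₂ s * σ l₁ l₂ (s+2)
        = a₁ l₁ * b * σ (l₁+1) l₂ (s+1) * σ l₁ l₂ (s+1))
      ∧ ((1 + a₂ l₂ * b) * σ l₁ (l₂+1) (s+2) * σ l₁ l₂ s - σ l₁ (l₂+1) s * σ l₁ l₂ (s+2)
        = a₂ l₂ * b * σ l₁ (l₂+1) (s+1) * σ l₁ l₂ (s+1)) := by
  intro l₁ l₂ s
  have hq0 : ∀ i, q i ≠ 0 := by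
    intro i h
    apply hpb i
    rw [hq] at h
    linear_combination -h
  have hc : ∀ i, p i * (p i + b) ≠ 0 := fun i => mul_ne_zero (hp i) (hpb i)
  have hrec : ∀ i l₁ l₂ s, φ i l₁ l₂ (s+2) + b * φ i l₁ l₂ (s+1)
      = p i * (p i + b) * φ i l₁ l₂ s := by
    intro i l₁ l₂ s
    have e1 : p i ^ (s+2) = p i ^ s * p i ^ 2 := by
      rw [zpow_add₀ (hp i)]; norm_cast
    have e2 : q i ^ (s+2) = q i ^ s * q i ^ 2 := by
      rw [zpow_add₀ (hq0 i)]; norm_cast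
    simp only [hφ, zpow_add_one₀ (hp i), zpow_add_one₀ (hq0 i), e1, e2]
    generalize q i ^ s = Q
    rw [hq i]
    ring
  constructor
  · refine core (fun i s => φ i (l₁+1) l₂ s) (fun i s => φ i l₁ l₂ s) (a₁ l₁) b _ hc
      (fun i s => hrec i _ _ s) ?_ s (fun s => σ (l₁+1) l₂ s) (fun s => σ l₁ l₂ s)
      (fun s => hσ _ _ s) (fun s => hσ _ _ s)
    intro i s
    simp only [hφ, zpow_add_one₀ (hp i), zpow_add_one₀ (hq0 i), ← hP₁ i l₁, ← hQ₁ i l₁]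
    ring
  · refine core (fun i s => φ i l₁ (l₂+1) s) (fun i s => φ i l₁ l₂ s) (a₂ l₂) b _ hc
      (fun i s => hrec i _ _ s) ?_ s (fun s => σ l₁ (l₂+1) s) (fun s => σ l₁ l₂ s)
      (fun s => hσ _ _ s) (fun s => hσ _ _ s)
    intro i s
    simp only [hφ, zpow_add_one₀ (hp i), zpow_add_one₀ (hq0 i), ← hP₂ i l₂, ← hQ₂ i l₂]
    ring
end

section
/- Let b ∈ ℂ, c₂ : ℤ → ℂ, and for each integer i ≥ 1 let pᵢ, Aᵢ, Bᵢ ∈ ℂ with pᵢ ≠ 0 and pᵢ + b ≠ 0, set qᵢ = −pᵢ − b, and let Pᵢ, Qᵢ : ℤ → ℂ satisfy Pᵢ(l+1) = (1 − c₂(l)pᵢ)·Pᵢ(l) and Qᵢ(l+1) = (1 − c₂(l)qᵢ)·Qᵢ(l) for all l ∈ ℤ. Define φᵢ(l₂,s) = Aᵢ·pᵢ^s·Pᵢ(l₂) + Bᵢ·qᵢ^s·Qᵢ(l₂) (integer powers of nonzero pᵢ, qᵢ), and for l₁ ∈ ℕ the l₁×l₁ Casorati determinant κ(l₁,l₂,s)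 = det( φᵢ(l₂,s+j−1) )_{i,j=1,…,l₁} (κ = 1 when l₁ = 0). Then for all l₁ ∈ ℕ and (l₂,s) ∈ ℤ²: (a) c₁(l₁)·κ(l₁,l₂,s+2)·κ(l₁+1,l₂,s) − κ(l₁,l₂,s)·κ(l₁+1,l₂,s+2) = b·κ(l₁,l₂,s+1)·κ(l₁+1,l₂,s+1), where c₁(l₁) = p_{l₁+1}·(p_{l₁+1}+b); and (b) (1+c₂(l₂)b)·κ(l₁,l₂,s+2)·κ(l₁,l₂+1,s) − κ(l₁,l₂,s)·κ(l₁,l₂+1,s+2) = c₂(l₂)·b·κ(l₁,l₂,s+1)·κ(l₁,l₂+1,s+1). -/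
theorem aux_plucker {n : Type*} [Fintype n] [DecidableEq n] (A : Matrix n n ℂ) (i j : n) (hij : i ≠ j)
    (c d : n → ℂ) :
    A.det * ((A.updateCol i c).updateCol j d).det =
      (A.updateCol i d).det * ((A.updateCol i c).updateCol j (fun r => A r i)).det
      + (A.updateCol j d).det * (A.updateCol i c).det := by
  rw [← Matrix.det_updateCol_smul, ← Matrix.mulVec_cramer]
  have h1 : A.mulVec (A.cramer d) = ∑ k, A.cramer d k • (fun r => A r k) := by
    ext r
    simp [Matrix.mulVec, dotProduct, mul_comm]
  have hlin : ∀ x : n → ℂ, ((A.updateCol i c).updateCol j x).det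
      = (A.updateCol i c).cramer x j := fun x => (Matrix.cramer_apply _ _ _).symm
  rw [h1, hlin, map_sum, Finset.sum_apply]
  have h2 : ∀ k ∈ Finset.univ, k ∉ ({i, j} : Finset n) →
      ((A.updateCol i c).cramer (A.cramer d k • (fun r => A r k))) j = 0 := by
    intro k _ hk
    simp only [Finset.mem_insert, Finset.mem_singleton, not_or] at hk
    rw [map_smul, Pi.smul_apply, ← hlin]
    rw [Matrix.det_zero_of_column_eq (i := j) (j := k) (Ne.symm hk.2), smul_zero]
    intro r
    simp [Matrix.updateCol_apply, hk.1, hk.2]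
  rw [← Finset.sum_subset (Finset.subset_univ {i, j}) h2, Finset.sum_pair hij]
  have h3 : (A.updateCol i c).updateCol j (fun r => A r j) = A.updateCol i c := by
    ext r k
    by_cases hk : k = j
    · subst hk; simp [Matrix.updateCol_apply, Ne.symm hij]
    · simp [Matrix.updateCol_apply, hk]
  rw [map_smul, map_smul, Pi.smul_apply, Pi.smul_apply, ← hlin, ← hlin, h3, smul_eq_mul,
    smul_eq_mul, Matrix.cramer_apply, Matrix.cramer_apply]

/-- column elimination -/
theorem aux_elim (b : ℂ) (M : ℕ) (C : Fin (M+1) → ℂ) (w : Fin (M+1) → ℂ)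
    (v : ℕ → Fin (M+1) → ℂ)
    (hw : ∀ i, C i * w i = v 1 i)
    (hv : ∀ j i, v (j+2) i = C i * v j i - b * v (j+1) i) :
    (Matrix.of fun i j : Fin (M+1) => v (j.1+1) i).det =
      (∏ i, C i) * (Matrix.of fun i (j : Fin (M+1)) =>
        (Fin.cons (w i) (fun k : Fin M => v k.1 i) : Fin (M+1) → ℂ) j).det := by
  rw [← Matrix.det_mul_column]
  refine Matrix.det_eq_of_forall_col_eq_smul_add_pred (fun _ => -b) ?_ ?_
  · intro i; simp [hw]
  · intro i j
    simp [hv j.1 i]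
    ring

theorem aux_last_col (N : ℕ) (A : Matrix (Fin (N+1)) (Fin (N+1)) ℂ)
    (h : ∀ i : Fin N, A i.castSucc (Fin.last N) = 0) (h1 : A (Fin.last N) (Fin.last N) = 1) :
    A.det = (A.submatrix Fin.castSucc Fin.castSucc).det := by
  rw [Matrix.det_succ_column A (Fin.last N), Fin.sum_univ_castSucc]
  simp [h, h1, Fin.succAbove_last, ← two_mul]

theorem aux_first_col (N : ℕ) (A : Matrix (Fin (N+1)) (Fin (N+1)) ℂ)
    (h : ∀ i : Fin N, A i.castSucc 0 = 0) (h1 : A (Fin.last N) 0 = 1) :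
    A.det = (-1)^N * (A.submatrix Fin.castSucc Fin.succ).det := by
  rw [Matrix.det_succ_column_zero A, Fin.sum_univ_castSucc]
  simp [h, h1, Fin.succAbove_last]

theorem aux_a (b : ℂ) (N : ℕ) (C : Fin (N+1) → ℂ) (hC : ∀ i, C i ≠ 0)
    (v : ℕ → Fin (N+1) → ℂ)
    (hv : ∀ j i, v (j+2) i = C i * v j i - b * v (j+1) i)
    (K L : ℕ → ℂ)
    (hK : ∀ k, K k = (Matrix.of fun i j : Fin N => v (k+j.1) i.castSucc).det)
    (hL : ∀ k, L k = (Matrix.of fun i j : Fin (N+1) => v (k+j.1) i).det) :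
    C (Fin.last N) * K 2 * L 0 - K 0 * L 2 = b * K 1 * L 1 := by
  rcases N with _ | M
  · simp [hK, hL, hv 0]
  -- columns (x, v 1, ..., v M, y)
  let F : (Fin (M+2) → ℂ) → (Fin (M+2) → ℂ) → ℂ := fun x y =>
    (Matrix.of fun i (j : Fin (M+2)) => (Fin.cons (x i)
      (Fin.snoc (fun k : Fin M => v (k.1+1) i) (y i) : Fin (M+1) → ℂ) : Fin (M+2) → ℂ) j).det
  let w : Fin (M+2) → ℂ := fun i => (C i)⁻¹ * v 1 i
  let w2 : Fin (M+2) → ℂ := fun i => (C i)⁻¹ * v 2 i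
  let e : Fin (M+2) → ℂ := Pi.single (Fin.last _) 1
  have hw : ∀ i, C i * w i = v 1 i := fun i => mul_inv_cancel_left₀ (hC i) _
  have hw2 : ∀ i, C i * w2 i = v 2 i := fun i => mul_inv_cancel_left₀ (hC i) _
  have hww : w2 = v 0 + (-b) • w := by
    ext i
    apply mul_left_cancel₀ (hC i)
    rw [hw2, hv 0]
    simp only [Pi.add_apply, Pi.smul_apply, smul_eq_mul]
    linear_combination b * hw i
  have hF : ∀ x y A, A = (Matrix.of fun i (j : Fin (M+2)) => (Fin.cons (x i)
      (Fin.snoc (fun k : Fin M => v (k.1+1) i) (y i) : Fin (M+1) → ℂ) : Fin (M+2) → ℂ) j) →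
      F x y = A.det := by rintro x y A rfl; rfl
  have hupd0 : ∀ x y z : Fin (M+2) → ℂ, (Matrix.of fun i (j : Fin (M+2)) => (Fin.cons (x i)
      (Fin.snoc (fun k : Fin M => v (k.1+1) i) (y i) : Fin (M+1) → ℂ) : Fin (M+2) → ℂ) j).updateCol 0 z
      = (Matrix.of fun i (j : Fin (M+2)) => (Fin.cons (z i)
      (Fin.snoc (fun k : Fin M => v (k.1+1) i) (y i) : Fin (M+1) → ℂ) : Fin (M+2) → ℂ) j) := by
    intro x y z
    ext i j
    refine Fin.cases ?_ (fun k => ?_) j <;> simp [Matrix.updateCol_apply]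
  have hupd1 : ∀ x y z : Fin (M+2) → ℂ, (Matrix.of fun i (j : Fin (M+2)) => (Fin.cons (x i)
      (Fin.snoc (fun k : Fin M => v (k.1+1) i) (y i) : Fin (M+1) → ℂ) : Fin (M+2) → ℂ) j).updateCol (Fin.last (M+1)) z
      = (Matrix.of fun i (j : Fin (M+2)) => (Fin.cons (x i)
      (Fin.snoc (fun k : Fin M => v (k.1+1) i) (z i) : Fin (M+1) → ℂ) : Fin (M+2) → ℂ) j) := by
    intro x y z
    ext i j
    refine Fin.cases ?_ (fun k => ?_) j
    · simp [Matrix.updateCol_apply, Fin.ext_iff]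
    · refine Fin.lastCases ?_ (fun k => ?_) k
      · simp [Matrix.updateCol_apply]
      · have := k.2.ne
        simp [Matrix.updateCol_apply, Fin.ext_iff, this]
  have hFlin : ∀ x x' y (t : ℂ), F (x + t • x') y = F x y + t * F x' y := by
    intro x x' y t
    simp only [F]
    rw [← hupd0 x y (x + t • x'), Matrix.det_updateCol_add, Matrix.det_updateCol_smul, hupd0, hupd0]
  have hpl : F (v 0) (v (M+1)) * F w e = F e (v (M+1)) * F w (v 0) + F (v 0) e * F w (v (M+1)) := by
    have := aux_plucker (Matrix.of fun i (j : Fin (M+2)) => (Fin.cons (v 0 i)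
      (Fin.snoc (fun k : Fin M => v (k.1+1) i) (v (M+1) i) : Fin (M+1) → ℂ) : Fin (M+2) → ℂ) j)
      0 (Fin.last (M+1)) (by simp [Fin.ext_iff]) w e
    simp only [hupd0, hupd1] at this
    simpa [F] using this
  have hrow : ∀ i (k : Fin (M+1)), (Fin.snoc (fun k : Fin M => v (k.1+1) i) (v (M+1) i) : Fin (M+1) → ℂ) k
      = v (k.1+1) i := by
    intro i k
    refine Fin.lastCases ?_ (fun k => ?_) k <;> simp
  have hcastrow : ∀ (x y : ℂ) i (k : Fin (M+1)), (Fin.cons x (Fin.snoc (fun k : Fin M => v (k.1+1) i) y : Fin (M+1) → ℂ) : Fin (M+2) → ℂ) k.castSucc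
      = (Fin.cons x (fun k : Fin M => v (k.1+1) i) : Fin (M+1) → ℂ) k := by
    intro x y i k
    refine Fin.cases ?_ (fun k => ?_) k
    · simp
    · rw [← Fin.succ_castSucc]; simp
  have hL0 : L 0 = F (v 0) (v (M+1)) := by
    rw [hL]; symm; apply hF
    ext i j
    refine Fin.cases ?_ (fun k => ?_) j
    · simp
    · simp [hrow]
  have hL2 : L 2 = (∏ i, C i) * F w2 (v (M+1)) := by
    have := aux_elim b (M+1) C w2 (fun j => v (j+1)) hw2 (fun j i => hv (j+1) i)
    rw [hL]
    have h1 : (Matrix.of fun i j : Fin (M+2) => v (2+j.1) i) = (Matrix.of fun i j : Fin (M+2) => v (j.1+1+1) i) := by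
      ext i j; simp only [Matrix.of_apply]; congr 1; omega
    rw [h1, this]
    congr 1
    symm
    apply hF
    ext i j
    refine Fin.cases ?_ (fun k => ?_) j
    · simp
    · simp [hrow]
  have hL1 : L 1 = (∏ i, C i) * ((-1)^M * F w (v 0)) := by
    have := aux_elim b (M+1) C w v hw hv
    rw [hL]
    have h1 : (Matrix.of fun i j : Fin (M+2) => v (1+j.1) i) = (Matrix.of fun i j : Fin (M+2) => v (j.1+1) i) := by
      ext i j; simp [add_comm]
    rw [h1, this]
    congr 1
    simp only [F]
    rw [Matrix.det_succ_column_zero, Matrix.det_succ_column_zero, Finset.mul_sum]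
    refine Finset.sum_congr rfl fun r _ => ?_
    have h2 : ((Matrix.of fun i (j : Fin (M+2)) => (Fin.cons (w i)
      (Fin.snoc (fun k : Fin M => v (k.1+1) i) (v 0 i) : Fin (M+1) → ℂ) : Fin (M+2) → ℂ) j).submatrix r.succAbove Fin.succ)
      = (((Matrix.of fun i (j : Fin (M+2)) => (Fin.cons (w i) (fun k : Fin (M+1) => v k.1 i) : Fin (M+2) → ℂ) j)).submatrix r.succAbove Fin.succ).submatrix id (finRotate (M+1)) := by
      ext i j
      refine Fin.lastCases ?_ (fun k => ?_) j
      · simp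
      · simp
    rw [h2, Matrix.det_permute', sign_finRotate]
    have h3 : ((-1 : ℂ)^M) * (-1)^M = 1 := by rw [← mul_pow]; simp
    simp
    linear_combination (-((-1)^(r:ℕ) * w r * ((((Matrix.of fun i (j : Fin (M+2)) => (Fin.cons (w i) (fun k : Fin (M+1) => v k.1 i) : Fin (M+2) → ℂ) j)).submatrix r.succAbove Fin.succ).det))) * h3
  have hFe : ∀ x : Fin (M+2) → ℂ, F x e = (Matrix.of fun (i : Fin (M+1)) (j : Fin (M+1)) =>
      (Fin.cons (x i.castSucc) (fun k : Fin M => v (k.1+1) i.castSucc) : Fin (M+1) → ℂ) j).det := by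
    intro x
    simp only [F]
    rw [aux_last_col]
    · congr 1
      ext i j
      simp [hcastrow]
    · intro i
      rw [← Fin.succ_last]
      simp [e, Fin.ext_iff, i.2.ne, Pi.single_apply]
    · rw [← Fin.succ_last]
      simp [e]
  have hK0 : K 0 = F (v 0) e := by
    rw [hK, hFe]
    congr 1
    ext i j
    refine Fin.cases ?_ (fun k => ?_) j <;> simp
  have hK1 : F e (v (M+1)) = (-1)^(M+1) * K 1 := by
    rw [hK]
    simp only [F]
    rw [aux_first_col]
    · congr 2
      ext i j
      simp [hrow, add_comm]
    · intro i
      simp [e, Fin.ext_iff, i.2.ne, Pi.single_apply]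
    · simp [e]
  have hK2 : C (Fin.last _) * K 2 = (∏ i, C i) * F w2 e := by
    have := aux_elim b M (fun i => C i.castSucc) (fun i => w2 i.castSucc) (fun j i => v (j+1) i.castSucc)
      (fun i => hw2 _) (fun j i => hv (j+1) _)
    rw [hFe, Fin.prod_univ_castSucc, hK]
    have h1 : (Matrix.of fun i j : Fin (M+1) => v (2+j.1) i.castSucc) = (Matrix.of fun i j : Fin (M+1) => v (j.1+1+1) i.castSucc) := by
      ext i j; simp only [Matrix.of_apply]; congr 1; omega
    rw [h1, this]; ring
  have h3 : ((-1 : ℂ)^M) * (-1)^M = 1 := by rw [← mul_pow]; simp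
  rw [hK2, hL0, hL2, hK0, hL1, hww, hFlin, hFlin]
  rw [hK1] at hpl
  linear_combination (-b * ∏ i, C i) * hpl + 0 * h3

theorem aux_b (b : ℂ) (N : ℕ) (C : Fin N → ℂ) (hC : ∀ i, C i ≠ 0)
    (v : ℕ → Fin N → ℂ)
    (hv : ∀ j i, v (j+2) i = C i * v j i - b * v (j+1) i)
    (K : ℕ → ℂ) (L : ℕ → ℂ → ℂ)
    (hK : ∀ k, K k = (Matrix.of fun i j : Fin N => v (k+j.1) i).det)
    (hL : ∀ k c, L k c = (Matrix.of fun i j : Fin N => v (k+j.1) i - c * v (k+j.1+1) i).det) (c : ℂ) :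
    (1 + c * b) * K 2 * L 0 c - K 0 * L 2 c = c * b * K 1 * L 1 c := by
  have hcont : ∀ k, Continuous (L k) := by
    intro k
    have : L k = fun c => (Matrix.of fun i j : Fin N => v (k+j.1) i - c * v (k+j.1+1) i).det := by
      ext c; exact hL k c
    rw [this]
    refine Continuous.matrix_det ?_
    refine continuous_matrix fun i j => ?_
    simp only [Matrix.of_apply]
    fun_prop
  have h0 := hcont 0
  have h1 := hcont 1
  have h2 := hcont 2
  have hd : Dense ({0, -b⁻¹} : Set ℂ)ᶜ := (Set.Finite.countable (Set.toFinite _)).dense_compl ℂ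
  refine congrFun (Continuous.ext_on (f := fun c => (1 + c * b) * K 2 * L 0 c - K 0 * L 2 c)
    (g := fun c => c * b * K 1 * L 1 c) hd (by fun_prop) (by fun_prop) ?_) c
  clear c
  intro c hc
  simp only [Set.mem_compl_iff, Set.mem_insert_iff, Set.mem_singleton_iff, not_or] at hc
  obtain ⟨hc0, hc1⟩ := hc
  have hcb : 1 + c * b ≠ 0 := by
    intro h
    apply hc1
    have hb : b ≠ 0 := by rintro rfl; simp at h
    field_simp
    linear_combination h
  let V : ℕ → Fin (N+1) → ℂ := fun j => Fin.snoc (v j) (c⁻¹ ^ j)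
  have hLV : ∀ k, (Matrix.of fun i j : Fin (N+1) => V (k+j.1) i).det = c⁻¹ ^ (k+N) * L k c := by
    intro k
    let A : Matrix (Fin (N+1)) (Fin (N+1)) ℂ := Matrix.of fun i (j : Fin (N+1)) =>
      (Fin.cons (V k i) (fun j : Fin N => V (k+j.1+1) i - c⁻¹ * V (k+j.1) i) : Fin (N+1) → ℂ) j
    have hA : (Matrix.of fun i j : Fin (N+1) => V (k+j.1) i).det = A.det := by
      refine Matrix.det_eq_of_forall_col_eq_smul_add_pred (fun _ => c⁻¹) ?_ ?_
      · intro i; simp [A]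
      · intro i j; simp [A, add_assoc]
    rw [hA, Matrix.det_succ_row A (Fin.last N), Fin.sum_univ_succ]
    have hz : ∀ j : Fin N, A (Fin.last N) j.succ = 0 := by
      intro j
      simp [A, V, pow_succ, mul_comm]
    have hs : A.submatrix (Fin.last N).succAbove (Fin.succAbove 0) = (-c⁻¹) •
        (Matrix.of fun i j : Fin N => v (k+j.1) i - c * v (k+j.1+1) i) := by
      ext i j
      simp [A, V, Fin.succAbove_last]
      field_simp
      ring
    simp only [hz, hs, Matrix.det_smul, hL]
    have h3 : ((-1 : ℂ)^N) * (-1)^N = 1 := by rw [← mul_pow]; simp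
    simp [A, V]
    rw [neg_pow, pow_add]
    generalize Matrix.det (Matrix.of fun i j : Fin N => v (k+j.1) i - c * v (k+j.1+1) i) = D
    linear_combination (c⁻¹^k * c⁻¹^N * D) * h3
  have key := aux_a b N (Fin.snoc C (c⁻¹ * (c⁻¹ + b))) (by
      intro i
      refine Fin.lastCases ?_ (fun i => ?_) i
      · simp only [Fin.snoc_last]
        have : c⁻¹ * (c⁻¹ + b) = (1 + c * b) / c^2 := by field_simp
        rw [this]; positivity
      · simpa using hC i) V (by
      intro j i
      refine Fin.lastCases ?_ (fun i => ?_) i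
      · simp only [V, Fin.snoc_last]; ring
      · simpa [V] using hv j i) K (fun k => c⁻¹ ^ (k+N) * L k c) (by
      intro k; rw [hK]; simp [V]) (fun k => (hLV k).symm)
  simp only [Fin.snoc_last] at key
  have hcN : c⁻¹ ^ (N+2) ≠ 0 := by positivity
  apply mul_left_cancel₀ hcN
  have e1 : c⁻¹ * c = 1 := inv_mul_cancel₀ hc0
  have e2 : c⁻¹ ^ (N+2) * c = c⁻¹ ^ (N+1) := by
    rw [pow_succ _ (N+1), mul_assoc, e1, mul_one]
  have e3 : c⁻¹ ^ (N+2) * (1 + c * b) = c⁻¹ * (c⁻¹ + b) * c⁻¹ ^ N := by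
    linear_combination b * e2
  rw [Nat.add_comm 2 N, Nat.add_comm 1 N, zero_add] at key
  linear_combination key + (K 2 * L 0 c) * e3 - (b * K 1 * L 1 c) * e2


/-- The molecule-type Casorati determinant built from soliton-type entries with the reduction
condition `qᵢ = -pᵢ - b` satisfies the bilinear equations of the discrete Schwarzian KdV
equation, where the determinant size `l₁` serves as a lattice direction with coefficient
`c₁(l₁) = p_{l₁+1}(p_{l₁+1}+b)`. The data `pᵢ, Aᵢ, Bᵢ, Pᵢ, Qᵢ` are indexed by integers
`i ≥ 1`. -/
theorem stmt_8 (b : ℂ) (c₂ : ℤ → ℂ)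
    (p A B : ℕ → ℂ)
    (hp : ∀ i : ℕ, 1 ≤ i → p i ≠ 0) (hpb : ∀ i : ℕ, 1 ≤ i → p i + b ≠ 0)
    (q : ℕ → ℂ) (hq : ∀ i : ℕ, 1 ≤ i → q i = -(p i) - b)
    (P Q : ℕ → ℤ → ℂ)
    (hP : ∀ i : ℕ, 1 ≤ i → ∀ l : ℤ, P i (l+1) = (1 - c₂ l * p i) * P i l)
    (hQ : ∀ i : ℕ, 1 ≤ i → ∀ l : ℤ, Q i (l+1) = (1 - c₂ l * q i) * Q i l)
    (φ : ℕ → ℤ → ℤ → ℂ)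
    (hφ : ∀ i : ℕ, 1 ≤ i → ∀ l₂ s : ℤ,
      φ i l₂ s = A i * p i ^ s * P i l₂ + B i * q i ^ s * Q i l₂)
    (κ : ℕ → ℤ → ℤ → ℂ)
    (hκ : ∀ (l₁ : ℕ) (l₂ s : ℤ),
      κ l₁ l₂ s = Matrix.det (Matrix.of fun i j : Fin l₁ => φ (i.1 + 1) l₂ (s + (j.1 : ℤ)))) :
    ∀ (l₁ : ℕ) (l₂ s : ℤ),
      (p (l₁+1) * (p (l₁+1) + b) * κ l₁ l₂ (s+2) * κ (l₁+1) l₂ s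
          - κ l₁ l₂ s * κ (l₁+1) l₂ (s+2)
        = b * κ l₁ l₂ (s+1) * κ (l₁+1) l₂ (s+1))
      ∧ ((1 + c₂ l₂ * b) * κ l₁ l₂ (s+2) * κ l₁ (l₂+1) s - κ l₁ l₂ s * κ l₁ (l₂+1) (s+2)
        = c₂ l₂ * b * κ l₁ l₂ (s+1) * κ l₁ (l₂+1) (s+1)) := by
  intro l₁ l₂ s
  have hq0 : ∀ i : ℕ, 1 ≤ i → q i ≠ 0 := by
    intro i hi h
    apply hpb i hi
    rw [hq i hi] at h
    linear_combination -h
  have hrec : ∀ i : ℕ, 1 ≤ i → ∀ t : ℤ,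
      φ i l₂ (t+2) = (p i * (p i + b)) * φ i l₂ t - b * φ i l₂ (t+1) := by
    intro i hi t
    rw [hφ i hi, hφ i hi, hφ i hi, zpow_add₀ (hp i hi), zpow_add₀ (hq0 i hi),
      zpow_add₀ (hp i hi), zpow_add₀ (hq0 i hi), zpow_one, zpow_one, zpow_ofNat, zpow_ofNat]
    have := hq i hi
    generalize p i ^ t = x
    generalize q i ^ t = y
    rw [this]
    ring
  have hshift : ∀ i : ℕ, 1 ≤ i → ∀ t : ℤ,
      φ i (l₂+1) t = φ i l₂ t - c₂ l₂ * φ i l₂ (t+1) := by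
    intro i hi t
    rw [hφ i hi, hφ i hi, hφ i hi, zpow_add₀ (hp i hi), zpow_add₀ (hq0 i hi), zpow_one, zpow_one,
      hP i hi, hQ i hi]
    ring
  have hC : ∀ i : ℕ, 1 ≤ i → p i * (p i + b) ≠ 0 := fun i hi => mul_ne_zero (hp i hi) (hpb i hi)
  constructor
  · have := aux_a b l₁ (fun i => p (i.1+1) * (p (i.1+1) + b)) (fun i => hC _ (by omega))
      (fun j i => φ (i.1+1) l₂ (s + j))
      (by
        intro j i
        have := hrec (i.1+1) (by omega) (s+j)
        push_cast
        rw [← add_assoc, ← add_assoc]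
        exact this)
      (fun k => κ l₁ l₂ (s+k)) (fun k => κ (l₁+1) l₂ (s+k))
      (by intro k; rw [hκ]; simp [add_assoc]) (by intro k; rw [hκ]; simp [add_assoc])
    simpa using this
  · have := aux_b b l₁ (fun i => p (i.1+1) * (p (i.1+1) + b)) (fun i => hC _ (by omega))
      (fun j i => φ (i.1+1) l₂ (s + j))
      (by
        intro j i
        have := hrec (i.1+1) (by omega) (s+j)
        push_cast
        rw [← add_assoc, ← add_assoc]
        exact this)
      (fun k => κ l₁ l₂ (s+k))
      (fun k c => (Matrix.of fun i j : Fin l₁ =>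
        φ (i.1+1) l₂ (s + ((k+j.1 : ℕ) : ℤ)) - c * φ (i.1+1) l₂ (s + ((k+j.1+1 : ℕ) : ℤ))).det)
      (by intro k; rw [hκ]; simp [add_assoc]) (by intro k c; rfl) (c₂ l₂)
    have hk : ∀ k : ℕ, κ l₁ (l₂+1) (s+k) = (Matrix.of fun i j : Fin l₁ =>
        φ (i.1+1) l₂ (s + ((k+j.1 : ℕ) : ℤ)) - c₂ l₂ * φ (i.1+1) l₂ (s + ((k+j.1+1 : ℕ) : ℤ))).det := by
      intro k
      rw [hκ]
      congr 1
      ext i j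
      simp only [Matrix.of_apply]
      rw [hshift _ (by omega)]
      push_cast
      simp only [add_assoc]
    simp only [← hk] at this
    simpa using this
end
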